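/- Let p : ({-1,1}^n)^d → ℝ be a block-multilinear polynomial of degree d and let D ∈ [d]. Let p_{=D} denote its homogeneous degree-D part, i.e., the block-multilinear polynomial whose Fourier coefficient at S equals p̂(S) if |S| = D and 0 otherwise. Then ‖p_{=D}‖_cb ≤ ‖p‖_cb. -/

import Mathlib

noncomputable section

/-- `E m` is the Euclidean space `ℝ^m`. -/
abbrev E (m : ℕ) := EuclideanSpace ℝ (Fin m)

/-- A block-multilinear polynomial `p : ({-1,1}^n)^d → ℝ` is encoded by its Fourier
coefficients `g : (Fin d → Option (Fin n)) → ℝ`: a set `S` of pairs `(block, coordinate)`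
containing at most one pair from each block corresponds to the function `σ` with
`σ b = some i` iff `(b,i) ∈ S`.  `blockSize σ` is the cardinality `|S|`. -/
def blockSize {n d : ℕ} (σ : Fin d → Option (Fin n)) : ℕ :=
  (Finset.univ.filter fun b => (σ b).isSome).card

/-- The evaluation `p(A_1,…,A_d)` of a block-multilinear polynomial on `n`-tuples of
operators: `Σ_S p̂(S) A_{b_1}(i_1)⋯A_{b_s}(i_s)` (with identity in the blocks not
occurring in `S`, giving the ordered product over blocks `b_1 < ⋯ < b_s`). -/
def blockEval {n d m : ℕ} (g : (Fin d → Option (Fin n)) → ℝ)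
    (A : Fin d → Fin n → (E m →L[ℝ] E m)) : E m →L[ℝ] E m :=
  ∑ σ : Fin d → Option (Fin n),
    g σ • (List.ofFn fun b => Option.elim (σ b) 1 fun i => A b i).prod

/-- The completely bounded norm `‖p‖_cb`: the supremum of `‖p(A_1,…,A_d)‖_op` over all
`m` and all tuples of operators of norm at most 1. -/
def cbNorm {n d : ℕ} (g : (Fin d → Option (Fin n)) → ℝ) : ℝ :=
  sSup { r | ∃ (m : ℕ) (A : Fin d → Fin n → (E m →L[ℝ] E m)),
    (∀ b i, ‖A b i‖ ≤ 1) ∧ r = ‖blockEval g A‖ }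

/-- The influence of variable `(b,i)`: `Inf_{b,i}[p] = Σ_{S ∋ (b,i)} p̂(S)²`. -/
def inflB {n d : ℕ} (g : (Fin d → Option (Fin n)) → ℝ) (b : Fin d) (i : Fin n) : ℝ :=
  ∑ σ ∈ Finset.univ.filter (fun σ : Fin d → Option (Fin n) => σ b = some i), g σ ^ 2

/-- The variance `Var[p] = Σ_{S ≠ ∅} p̂(S)²`. -/
def varB {n d : ℕ} (g : (Fin d → Option (Fin n)) → ℝ) : ℝ :=
  ∑ σ ∈ Finset.univ.filter
      (fun σ : Fin d → Option (Fin n) => σ ≠ fun _ => none), g σ ^ 2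

/-- The block cyclic shift `T ⊗ S` on `V ⊗ ℝ^{N+1}`, where `S e_k = e_{k+1}`. -/
def cyclicShift {V : Type*} [NormedAddCommGroup V] [InnerProductSpace ℝ V] (N : ℕ)
    (T : V →L[ℝ] V) :
    PiLp 2 (fun _ : ZMod (N + 1) => V) →L[ℝ] PiLp 2 (fun _ : ZMod (N + 1) => V) :=
  LinearMap.mkContinuous
    { toFun := fun f => WithLp.toLp 2 fun k => T (f (k - 1))
      map_add' := fun f g => by ext k; simp
      map_smul' := fun c f => by ext k; simp }
    ‖T‖ (fun f => by
      refine le_of_sq_le_sq ?_ (by positivity)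
      rw [mul_pow, PiLp.norm_sq_eq_of_L2, PiLp.norm_sq_eq_of_L2,
        ← (Equiv.subRight (1 : ZMod (N + 1))).sum_comp (fun k => ‖f k‖ ^ 2), Finset.mul_sum]
      refine Finset.sum_le_sum fun k _ => ?_
      rw [← mul_pow]
      exact pow_le_pow_left₀ (norm_nonneg _) (T.le_opNorm _) 2)

lemma norm_cyclicShift_le {V : Type*} [NormedAddCommGroup V] [InnerProductSpace ℝ V] (N : ℕ)
    (T : V →L[ℝ] V) : ‖cyclicShift N T‖ ≤ ‖T‖ :=
  LinearMap.mkContinuous_norm_le _ (norm_nonneg T) _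

lemma cyclicShift_single {V : Type*} [NormedAddCommGroup V] [InnerProductSpace ℝ V] (N : ℕ)
    (T : V →L[ℝ] V) (k : ZMod (N + 1)) (v : V) :
    cyclicShift N T (PiLp.single 2 k v) = PiLp.single 2 (k + 1) (T v) := by
  ext j
  change T ((PiLp.single 2 k v : PiLp 2 (fun _ : ZMod (N + 1) => V)) (j - 1)) = _
  by_cases h : j = k + 1
  · subst h; simp
  · have h' : j - 1 ≠ k := fun e => h (by rw [← e, sub_add_cancel])
    simp [h, h']

lemma blockSize_succ {n d : ℕ} (σ : Fin (d + 1) → Option (Fin n)) :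
    blockSize σ = (if (σ 0).isSome then 1 else 0) + blockSize fun b : Fin d => σ b.succ := by
  simp only [blockSize, Finset.card_filter, Fin.sum_univ_succ]

lemma blockSize_le {n d : ℕ} (σ : Fin d → Option (Fin n)) : blockSize σ ≤ d :=
  (Finset.card_filter_le _ _).trans (by simp)

/-- If the family `J` intertwines each `A b i` with `A' b i` up to a unit shift of the index,
then it intertwines ordered products up to a shift by the number of factors. -/
lemma prod_intertwine {n m m' N d : ℕ} (J : ZMod (N + 1) → E m → E m')
    (A : Fin d → Fin n → (E m →L[ℝ] E m)) (A' : Fin d → Fin n → (E m' →L[ℝ] E m'))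
    (hJ : ∀ b i k v, A' b i (J k v) = J (k + 1) (A b i v))
    (σ : Fin d → Option (Fin n)) (k : ZMod (N + 1)) (v : E m) :
    (List.ofFn fun b => Option.elim (σ b) 1 fun i => A' b i).prod (J k v) =
      J (k + (blockSize σ : ZMod (N + 1)))
        ((List.ofFn fun b => Option.elim (σ b) 1 fun i => A b i).prod v) := by
  induction d with
  | zero => simp [blockSize]
  | succ d ih =>
    have := ih (fun b => A b.succ) (fun b => A' b.succ) (fun b => hJ b.succ) (fun b => σ b.succ)
    rw [blockSize_succ, List.ofFn_succ, List.ofFn_succ, List.prod_cons, List.prod_cons,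
      mul_apply_eq_comp, mul_apply_eq_comp, this]
    cases h : σ 0 with
    | none => simp
    | some i => simp [hJ, add_left_comm, add_comm]

lemma norm_prod_ofFn_le_one {n m d : ℕ} (A : Fin d → Fin n → (E m →L[ℝ] E m))
    (hA : ∀ b i, ‖A b i‖ ≤ 1) (σ : Fin d → Option (Fin n)) :
    ‖(List.ofFn fun b => Option.elim (σ b) 1 fun i => A b i).prod‖ ≤ 1 := by
  induction d with
  | zero => exact ContinuousLinearMap.norm_id_le
  | succ d ih =>
    rw [List.ofFn_succ, List.prod_cons]
    refine (norm_mul_le _ _).trans (mul_le_one₀ ?_ (norm_nonneg _)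
      (ih (fun b => A b.succ) (fun b => hA b.succ) fun b => σ b.succ))
    cases σ 0 with
    | none => exact ContinuousLinearMap.norm_id_le
    | some i => exact hA 0 i

lemma norm_blockEval_le_cbNorm {n d m : ℕ} (g : (Fin d → Option (Fin n)) → ℝ)
    (A : Fin d → Fin n → (E m →L[ℝ] E m)) (hA : ∀ b i, ‖A b i‖ ≤ 1) :
    ‖blockEval g A‖ ≤ cbNorm g := by
  refine le_csSup ⟨∑ σ, ‖g σ‖, ?_⟩ ⟨m, A, hA, rfl⟩
  rintro _ ⟨m, A, hA, rfl⟩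
  refine norm_sum_le_of_le _ fun σ _ => ?_
  rw [norm_smul]
  exact mul_le_of_le_one_right (norm_nonneg _) (norm_prod_ofFn_le_one A hA σ)

/-- For a block-multilinear polynomial `p` of degree `d` and `D ∈ [d]`,
the homogeneous degree-`D` part `p_{=D}` satisfies `‖p_{=D}‖_cb ≤ ‖p‖_cb`. -/
theorem stmt_7 {n d : ℕ} (g : (Fin d → Option (Fin n)) → ℝ)
    (D : ℕ) (hD1 : 1 ≤ D) (hD2 : D ≤ d) :
    cbNorm (fun σ : Fin d → Option (Fin n) => if blockSize σ = D then g σ else 0) ≤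
      cbNorm g := by
  refine csSup_le ⟨_, 0, 0, by simp, rfl⟩ ?_
  rintro _ ⟨m, A, hA, rfl⟩
  let H := PiLp 2 (fun _ : ZMod (d + 1) => E m)
  let φ : H ≃ₗᵢ[ℝ] E (Module.finrank ℝ H) := (stdOrthonormalBasis ℝ H).repr
  let A' : Fin d → Fin n → (E (Module.finrank ℝ H) →L[ℝ] E (Module.finrank ℝ H)) := fun b i =>
    φ.toLinearIsometry.toContinuousLinearMap ∘L cyclicShift d (A b i) ∘L
      φ.symm.toLinearIsometry.toContinuousLinearMap
  have hA' : ∀ b i, ‖A' b i‖ ≤ 1 := fun b i => by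
    refine ContinuousLinearMap.opNorm_le_bound _ zero_le_one fun x => ?_
    change ‖φ (cyclicShift d (A b i) (φ.symm x))‖ ≤ _
    rw [φ.norm_map, ← φ.symm.norm_map x]
    exact ContinuousLinearMap.le_of_opNorm_le _ ((norm_cyclicShift_le d _).trans (hA b i)) _
  let J : ZMod (d + 1) → E m → E (Module.finrank ℝ H) := fun k v => φ (PiLp.single 2 k v)
  have hJ : ∀ b i k v, A' b i (J k v) = J (k + 1) (A b i v) := fun b i k v => by
    change φ (cyclicShift d (A b i) (φ.symm (φ _))) = φ _
    rw [φ.symm_apply_apply, cyclicShift_single]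
  have key : ∀ v, φ.symm (blockEval g A' (J 0 v)) (D : ZMod (d + 1)) =
      blockEval (fun σ => if blockSize σ = D then g σ else 0) A v := fun v => by
    simp only [blockEval, sum_apply, smul_apply,
      prod_intertwine J A A' hJ, J, ← map_smul, ← map_sum, φ.symm_apply_apply]
    rw [WithLp.ofLp_sum, Finset.sum_apply]
    refine Finset.sum_congr rfl fun σ _ => ?_
    have hcast : ((D : ZMod (d + 1)) = (blockSize σ : ZMod (d + 1))) ↔ blockSize σ = D := by
      rw [ZMod.natCast_eq_natCast_iff', Nat.mod_eq_of_lt (by omega),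
        Nat.mod_eq_of_lt (Nat.lt_succ_of_le (blockSize_le σ)), eq_comm]
    change g σ • (PiLp.single 2 _ _ : PiLp 2 fun _ : ZMod (d + 1) => E m) (D : ZMod (d + 1)) = _
    by_cases h : blockSize σ = D
    · simp [h]
    · have h' := mt hcast.1 h
      simp [h, h']
  refine ContinuousLinearMap.opNorm_le_bound _
    ((norm_nonneg _).trans (norm_blockEval_le_cbNorm g A' hA')) fun v => ?_
  rw [← key v]
  calc _ ≤ ‖φ.symm (blockEval g A' (J 0 v))‖ := PiLp.norm_apply_le _ _
    _ = ‖blockEval g A' (J 0 v)‖ := φ.symm.norm_map _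
    _ ≤ cbNorm g * ‖J 0 v‖ :=
      ContinuousLinearMap.le_of_opNorm_le _ (norm_blockEval_le_cbNorm g A' hA') _
    _ = cbNorm g * ‖v‖ := by rw [φ.norm_map, PiLp.norm_single]
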